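/- arXiv:2110.10307 — 2 statements merged into one kernel-verified Lean document; each statement's English description precedes it below -/
import Mathlib

section
/- Outer bound, two sub-dealers, all-or-nothing access structure (Corollary 5): assume D = 2. Every achievable rate pair (R_1, R_2) ∈ C(𝔸*) satisfies: R_1 ≤ min_{T⊊ℒ} I(Y_1; X_ℒ, Y_2 | X_T), R_2 ≤ min_{T⊊ℒ} I(Y_2; X_ℒ, Y_1 | X_T), and R_1 + R_2 ≤ min_{T⊊ℒ} I(Y_𝒟; X_ℒ | X_T), the minima being over all strict subsets T of ℒ (including T = ∅). -/
open scoped BigOperators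
open Finset Filter

noncomputable section

namespace SecretSharing

open scoped Classical

/-! ### Basic Shannon information quantities (base 2) on finite probability spaces -/

variable {Ω : Type*} [Fintype Ω]

/-- `p` is a probability mass function on the finite type `Ω`. -/
def IsPMF (p : Ω → ℝ) : Prop := (∀ ω, 0 ≤ p ω) ∧ ∑ ω : Ω, p ω = 1

/-- Probability that the random variable `X` takes the value `a` under `p`. -/
def prob (p : Ω → ℝ) {A : Type*} (X : Ω → A) (a : A) : ℝ :=
  ∑ ω : Ω, if X ω = a then p ω else 0

/-- Shannon entropy (in bits) of the random variable `X` under `p`. -/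
def ent (p : Ω → ℝ) {A : Type*} [Fintype A] (X : Ω → A) : ℝ :=
  -∑ a : A, prob p X a * Real.logb 2 (prob p X a)

/-- Conditional Shannon entropy `H(X | Y)` in bits. -/
def condEnt (p : Ω → ℝ) {A B : Type*} [Fintype A] [Fintype B]
    (X : Ω → A) (Y : Ω → B) : ℝ :=
  ent p (fun ω => (X ω, Y ω)) - ent p Y

/-- Mutual information `I(X ; Y)` in bits. -/
def mutInf (p : Ω → ℝ) {A B : Type*} [Fintype A] [Fintype B]
    (X : Ω → A) (Y : Ω → B) : ℝ :=
  ent p X + ent p Y - ent p (fun ω => (X ω, Y ω))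

/-- Conditional mutual information `I(X ; Y | Z)` in bits. -/
def condMutInf (p : Ω → ℝ) {A B C : Type*} [Fintype A] [Fintype B] [Fintype C]
    (X : Ω → A) (Y : Ω → B) (Z : Ω → C) : ℝ :=
  condEnt p X Z - condEnt p X (fun ω => (Y ω, Z ω))

/-! ### The distributed secret-sharing model -/

variable {L D : ℕ} {𝒳 : Fin L → Type} {𝒴 : Fin D → Type}
variable [∀ l, Fintype (𝒳 l)] [∀ d, Fintype (𝒴 d)]

/-- Sample space for one source symbol: the participants' observations and the
sub-dealers' observations. -/
abbrev Base (𝒳 : Fin L → Type) (𝒴 : Fin D → Type) : Type := (∀ l, 𝒳 l) × (∀ d, 𝒴 d)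

/-- The i.i.d. product pmf of `p` over `n` source symbols. -/
def iid (p : Base 𝒳 𝒴 → ℝ) (n : ℕ) : (Fin n → Base 𝒳 𝒴) → ℝ :=
  fun ω => ∏ i, p (ω i)

/-- Observations `X_T` of the set `T` of participants (single symbol). -/
def XT (T : Finset (Fin L)) : Base 𝒳 𝒴 → ∀ l : {l // l ∈ T}, 𝒳 l.1 :=
  fun ω l => ω.1 l.1

/-- Observations `Y_S` of the set `S` of sub-dealers (single symbol). -/
def YS (S : Finset (Fin D)) : Base 𝒳 𝒴 → ∀ d : {d // d ∈ S}, 𝒴 d.1 :=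
  fun ω d => ω.2 d.1

/-- Observations `X_T^n` of the set `T` of participants over a block of length `n`. -/
def XTn (T : Finset (Fin L)) (n : ℕ) :
    (Fin n → Base 𝒳 𝒴) → ∀ l : {l // l ∈ T}, Fin n → 𝒳 l.1 :=
  fun ω l i => (ω i).1 l.1

/-- Cardinality `⌈2^{n R_d}⌉` of the secret alphabet of sub-dealer `d`. -/
def secCard (R : Fin D → ℝ) (n : ℕ) (d : Fin D) : ℕ := ⌈(2:ℝ) ^ ((n : ℝ) * R d)⌉₊

/-- A secret-sharing strategy at blocklength `n` with rates `R`, for the access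
structure `𝔸`: public messages, secrets, and decoders for authorized sets. -/
structure Strategy (𝒳 : Fin L → Type) (𝒴 : Fin D → Type)
    (𝔸 : Set (Finset (Fin L))) (R : Fin D → ℝ) (n : ℕ) where
  msgCard : Fin D → ℕ
  encM : ∀ d : Fin D, (Fin n → 𝒴 d) → Fin (msgCard d)
  encS : ∀ d : Fin D, (Fin n → 𝒴 d) → Fin (secCard R n d)
  dec : ∀ A : Finset (Fin L), A ∈ 𝔸 →
    (∀ l : {l // l ∈ A}, Fin n → 𝒳 l.1) → (∀ d, Fin (msgCard d)) →
      ∀ d, Fin (secCard R n d)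

variable {𝔸 : Set (Finset (Fin L))} {R : Fin D → ℝ} {n : ℕ}

/-- The public communication `M_𝒟` as a random variable. -/
def Strategy.Mrv (σ : Strategy 𝒳 𝒴 𝔸 R n) :
    (Fin n → Base 𝒳 𝒴) → ∀ d, Fin (σ.msgCard d) :=
  fun ω d => σ.encM d (fun i => (ω i).2 d)

/-- The secrets `S_𝒟` as a random variable. -/
def Strategy.Srv (σ : Strategy 𝒳 𝒴 𝔸 R n) :
    (Fin n → Base 𝒳 𝒴) → ∀ d, Fin (secCard R n d) :=
  fun ω d => σ.encS d (fun i => (ω i).2 d)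

/-- The estimate `Ŝ_𝒟(A)` computed by the authorized set `A`. -/
def Strategy.ShatRv (σ : Strategy 𝒳 𝒴 𝔸 R n) (A : Finset (Fin L)) (hA : A ∈ 𝔸) :
    (Fin n → Base 𝒳 𝒴) → ∀ d, Fin (secCard R n d) :=
  fun ω => σ.dec A hA (fun l i => (ω i).1 l.1) (σ.Mrv ω)

/-- Error probability `P[Ŝ_𝒟(A) ≠ S_𝒟]`. -/
def Strategy.err (p : Base 𝒳 𝒴 → ℝ) (σ : Strategy 𝒳 𝒴 𝔸 R n)
    (A : Finset (Fin L)) (hA : A ∈ 𝔸) : ℝ :=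
  ∑ ω : Fin n → Base 𝒳 𝒴, if σ.ShatRv A hA ω ≠ σ.Srv ω then iid p n ω else 0

/-- Information leakage `I(S_𝒟 ; M_𝒟, X_U^n)` to the set `U` of participants. -/
def Strategy.leak (p : Base 𝒳 𝒴 → ℝ) (σ : Strategy 𝒳 𝒴 𝔸 R n)
    (U : Finset (Fin L)) : ℝ :=
  mutInf (iid p n) σ.Srv (fun ω => (σ.Mrv ω, XTn U n ω))

/-- Uniformity defect `log₂|𝒮_𝒟| - H(S_𝒟)`. -/
def Strategy.unif (p : Base 𝒳 𝒴 → ℝ) (σ : Strategy 𝒳 𝒴 𝔸 R n) : ℝ :=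
  Real.logb 2 (∏ d, (secCard R n d : ℝ)) - ent (iid p n) σ.Srv

/-- Achievability of the rate tuple `R` for access structure `𝔸` and
unauthorized sets `𝕌`: a sequence of strategies with vanishing error
probability (for every authorized set), vanishing leakage (for every
unauthorized set), and vanishing uniformity defect. -/
def Achievable (p : Base 𝒳 𝒴 → ℝ) (𝔸 𝕌 : Set (Finset (Fin L)))
    (R : Fin D → ℝ) : Prop :=
  (∀ d, 0 ≤ R d) ∧
  ∃ σ : (n : ℕ) → Strategy 𝒳 𝒴 𝔸 R n,
    (∀ A : Finset (Fin L), ∀ hA : A ∈ 𝔸,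
      Tendsto (fun n => (σ n).err p A hA) atTop (nhds 0)) ∧
    (∀ U ∈ 𝕌, Tendsto (fun n => (σ n).leak p U) atTop (nhds 0)) ∧
    Tendsto (fun n => (σ n).unif p) atTop (nhds 0)

/-- `𝔸` is a monotone access structure: nonempty, not containing `∅`, and
closed under taking supersets. -/
def MonotoneAccess (𝔸 : Set (Finset (Fin L))) : Prop :=
  𝔸.Nonempty ∧ ∅ ∉ 𝔸 ∧ ∀ A ∈ 𝔸, ∀ T : Finset (Fin L), A ⊆ T → T ∈ 𝔸


section Aux

variable {Ω : Type*} [Fintype Ω]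

lemma sum_comp_prob (p : Ω → ℝ) {A : Type*} [Fintype A] (X : Ω → A) (g : A → ℝ) :
    ∑ ω, p ω * g (X ω) = ∑ a, prob p X a * g a := by
  unfold prob
  simp_rw [Finset.sum_mul]
  rw [Finset.sum_comm]
  refine Finset.sum_congr rfl fun ω _ => ?_
  simp [ite_mul]

lemma ent_eq (p : Ω → ℝ) {A : Type*} [Fintype A] (X : Ω → A) :
    ent p X = -∑ ω, p ω * Real.logb 2 (prob p X (X ω)) := by
  unfold ent
  rw [sum_comp_prob p X (fun a => Real.logb 2 (prob p X a))]

lemma prob_nonneg {p : Ω → ℝ} (hp : IsPMF p) {A : Type*} (X : Ω → A) (a : A) :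
    0 ≤ prob p X a := by
  unfold prob
  refine Finset.sum_nonneg fun ω _ => ?_
  split_ifs
  · exact hp.1 ω
  · exact le_rfl

lemma le_prob {p : Ω → ℝ} (hp : IsPMF p) {A : Type*} (X : Ω → A) (ω : Ω) :
    p ω ≤ prob p X (X ω) := by
  unfold prob
  have := Finset.single_le_sum (f := fun ω' => if X ω' = X ω then p ω' else 0)
    (s := Finset.univ) (fun i _ => by
      split_ifs
      · exact hp.1 i
      · exact le_rfl) (Finset.mem_univ ω)
  simpa using this

lemma prob_mono {p : Ω → ℝ} (hp : IsPMF p) {A B : Type*} (X : Ω → A) (Y : Ω → B)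
    (h : ∀ ω ω', X ω = X ω' → Y ω = Y ω') (ω : Ω) :
    prob p X (X ω) ≤ prob p Y (Y ω) := by
  unfold prob
  refine Finset.sum_le_sum fun ω' _ => ?_
  by_cases h1 : X ω' = X ω
  · simp [h1, h _ _ h1]
  · rw [if_neg h1]
    split_ifs
    · exact hp.1 ω'
    · exact le_rfl

lemma sum_prob {p : Ω → ℝ} (hp : IsPMF p) {A : Type*} [Fintype A] (X : Ω → A) :
    ∑ a, prob p X a = 1 := by
  have := sum_comp_prob p X (fun _ => 1)
  simp only [mul_one] at this
  rw [← this, hp.2]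

lemma sum_prob_pair (p : Ω → ℝ) {A B : Type*} [Fintype A] (X : Ω → A) (Y : Ω → B) (b : B) :
    ∑ a, prob p (fun ω => (X ω, Y ω)) (a, b) = prob p Y b := by
  unfold prob
  rw [Finset.sum_comm]
  refine Finset.sum_congr rfl fun ω _ => ?_
  by_cases h : Y ω = b <;> simp [h]

lemma ent_mono {p : Ω → ℝ} (hp : IsPMF p) {A B : Type*} [Fintype A] [Fintype B]
    (X : Ω → A) (Y : Ω → B) (h : ∀ ω ω', X ω = X ω' → Y ω = Y ω') :
    ent p Y ≤ ent p X := by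
  rw [ent_eq, ent_eq]
  refine neg_le_neg (Finset.sum_le_sum fun ω _ => ?_)
  rcases (hp.1 ω).eq_or_lt with h0 | h0
  · simp [← h0]
  · refine mul_le_mul_of_nonneg_left ?_ h0.le
    exact Real.logb_le_logb_of_le (by norm_num) (h0.trans_le (le_prob hp X ω))
      (prob_mono hp X Y h ω)

lemma ent_congr {p : Ω → ℝ} (hp : IsPMF p) {A B : Type*} [Fintype A] [Fintype B]
    (X : Ω → A) (Y : Ω → B) (h : ∀ ω ω', X ω = X ω' ↔ Y ω = Y ω') :
    ent p X = ent p Y :=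
  le_antisymm (ent_mono hp Y X fun ω ω' => (h ω ω').2)
    (ent_mono hp X Y fun ω ω' => (h ω ω').1)

lemma gibbs {p : Ω → ℝ} (hp : IsPMF p) {A : Type*} [Fintype A] (X : Ω → A) (q : A → ℝ)
    (hq : ∀ a, 0 ≤ q a) (hq1 : ∑ a, q a ≤ 1) (hpos : ∀ ω, 0 < p ω → 0 < q (X ω)) :
    ent p X ≤ -∑ ω, p ω * Real.logb 2 (q (X ω)) := by
  rw [ent_eq]
  refine neg_le_neg ?_
  have h2 : (0:ℝ) < Real.log 2 := Real.log_pos (by norm_num)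
  have key : ∀ ω, p ω * Real.logb 2 (q (X ω)) - p ω * Real.logb 2 (prob p X (X ω)) ≤
      (p ω * (q (X ω) / prob p X (X ω)) - p ω) / Real.log 2 := by
    intro ω
    rcases (hp.1 ω).eq_or_lt with h0 | h0
    · simp [← h0]
    · have hP := h0.trans_le (le_prob hp X ω)
      have hQ := hpos ω h0
      have hl := Real.log_le_sub_one_of_pos (div_pos hQ hP)
      rw [Real.log_div hQ.ne' hP.ne'] at hl
      have : p ω * Real.logb 2 (q (X ω)) - p ω * Real.logb 2 (prob p X (X ω)) =
        (p ω * (Real.log (q (X ω)) - Real.log (prob p X (X ω)))) / Real.log 2 := by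
        unfold Real.logb; ring
      rw [this]
      refine div_le_div_of_nonneg_right ?_ h2.le
      have := mul_le_mul_of_nonneg_left hl h0.le
      linarith
  have hs := Finset.sum_le_sum (s := Finset.univ) fun ω _ => key ω
  rw [Finset.sum_sub_distrib, ← Finset.sum_div, Finset.sum_sub_distrib, hp.2,
    sum_comp_prob p X (fun a => q a / prob p X a)] at hs
  have h3 : ∑ a, prob p X a * (q a / prob p X a) ≤ 1 := by
    refine le_trans (Finset.sum_le_sum fun a _ => ?_) hq1
    rcases eq_or_ne (prob p X a) 0 with h0 | h0
    · simp [h0, hq a]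
    · rw [mul_div_cancel₀ _ h0]
  have h4 : (∑ a, prob p X a * (q a / prob p X a) - 1) / Real.log 2 ≤ 0 :=
    div_nonpos_of_nonpos_of_nonneg (by linarith) h2.le
  linarith

lemma ent_le_log_card {p : Ω → ℝ} (hp : IsPMF p) {A : Type*} [Fintype A] [Nonempty A]
    (X : Ω → A) : ent p X ≤ Real.logb 2 (Fintype.card A) := by
  have hc : (0:ℝ) < Fintype.card A := by exact_mod_cast Fintype.card_pos
  have := gibbs hp X (fun _ => (Fintype.card A : ℝ)⁻¹) (fun _ => by positivity)
    (by simp) (fun _ _ => by positivity)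
  refine this.trans (le_of_eq ?_)
  rw [← Finset.sum_mul, hp.2, Real.logb_inv]
  ring

lemma submod {p : Ω → ℝ} (hp : IsPMF p) {A B C D : Type*} [Fintype A] [Fintype B]
    [Fintype C] [Fintype D] (U : Ω → A) (V : Ω → B) (J : Ω → C) (K : Ω → D)
    (hU : ∀ ω ω', U ω = U ω' → K ω = K ω') (hV : ∀ ω ω', V ω = V ω' → K ω = K ω')
    (hJ : ∀ ω ω', U ω = U ω' → V ω = V ω' → J ω = J ω') :
    ent p J + ent p K ≤ ent p U + ent p V := by
  have e1 : ent p U = ent p (fun ω => (U ω, K ω)) :=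
    ent_congr hp _ _ fun ω ω' => by
      simp only [Prod.mk.injEq]
      exact ⟨fun h => ⟨h, hU _ _ h⟩, fun h => h.1⟩
  have e2 : ent p V = ent p (fun ω => (V ω, K ω)) :=
    ent_congr hp _ _ fun ω ω' => by
      simp only [Prod.mk.injEq]
      exact ⟨fun h => ⟨h, hV _ _ h⟩, fun h => h.1⟩
  have e3 : ent p J ≤ ent p (fun ω => (U ω, V ω, K ω)) :=
    ent_mono hp _ _ fun ω ω' => by
      simp only [Prod.mk.injEq]
      exact fun h => hJ _ _ h.1 h.2.1
  let q : A × B × D → ℝ := fun x =>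
    prob p (fun ω => (U ω, K ω)) (x.1, x.2.2) * prob p (fun ω => (V ω, K ω)) (x.2.1, x.2.2)
      / prob p K x.2.2
  have hqs : ∑ x, q x ≤ 1 := by
    rw [← sum_prob hp K]
    rw [Fintype.sum_prod_type]
    simp_rw [Fintype.sum_prod_type]
    have : ∀ a, ∑ b, ∑ k, q (a, b, k) = ∑ k, ∑ b, q (a, b, k) := fun a => Finset.sum_comm
    simp_rw [this]
    rw [Finset.sum_comm]
    refine Finset.sum_le_sum fun k _ => ?_
    have : ∑ a, ∑ b, q (a, b, k) = prob p K k * prob p K k / prob p K k := by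
      simp only [q]
      simp_rw [← Finset.sum_div, ← Finset.mul_sum, ← Finset.sum_mul]
      rw [sum_prob_pair, sum_prob_pair]
    rw [this]
    rcases eq_or_ne (prob p K k) 0 with h0 | h0
    · simp [h0]
    · rw [mul_div_cancel_right₀ _ h0]
  have g := gibbs hp (fun ω => (U ω, V ω, K ω)) q
    (fun x => div_nonneg (mul_nonneg (prob_nonneg hp _ _) (prob_nonneg hp _ _))
      (prob_nonneg hp _ _)) hqs
    (fun ω h => div_pos (mul_pos (h.trans_le (le_prob hp (fun ω => (U ω, K ω)) ω))
      (h.trans_le (le_prob hp (fun ω => (V ω, K ω)) ω))) (h.trans_le (le_prob hp K ω)))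
  have g2 : -∑ ω, p ω * Real.logb 2 (q (U ω, V ω, K ω)) =
      ent p (fun ω => (U ω, K ω)) + ent p (fun ω => (V ω, K ω)) - ent p K := by
    rw [ent_eq, ent_eq, ent_eq, ← neg_add, ← Finset.sum_add_distrib, sub_neg_eq_add,
      neg_add_eq_sub, ← neg_sub, ← Finset.sum_sub_distrib]
    congr 1
    refine Finset.sum_congr rfl fun ω _ => ?_
    rcases (hp.1 ω).eq_or_lt with h0 | h0
    · simp [← h0]
    · have h1 := h0.trans_le (le_prob hp (fun ω => (U ω, K ω)) ω)
      have h2 := h0.trans_le (le_prob hp (fun ω => (V ω, K ω)) ω)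
      have h3 := h0.trans_le (le_prob hp K ω)
      simp only [q]
      rw [Real.logb_div (mul_pos h1 h2).ne' h3.ne', Real.logb_mul h1.ne' h2.ne']
      ring
  linarith

/-- A weak form of the Fano inequality. -/
lemma fano {p : Ω → ℝ} (hp : IsPMF p) {A B : Type*} [Fintype A] [Nonempty A] [Fintype B]
    (S : Ω → A) (W : Ω → B) (g : B → A) (Pe : ℝ)
    (hPe : ∑ ω, Set.indicator {ω | g (W ω) ≠ S ω} p ω ≤ Pe) :
    ent p (fun ω => (S ω, W ω)) - ent p W ≤
      1 + Pe * Real.logb 2 (Fintype.card A) := by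
  have hc : (0:ℝ) < Fintype.card A := by exact_mod_cast Fintype.card_pos
  let r : A → B → ℝ := fun s w => if g w = s then 1/2 else (2 * (Fintype.card A : ℝ))⁻¹
  have hr : ∀ s w, 0 < r s w := by
    intro s w
    simp only [r]
    split_ifs <;> positivity
  have hrs : ∀ w, ∑ s, r s w ≤ 1 := by
    intro w
    calc ∑ s, r s w ≤ ∑ s, ((if g w = s then 1/2 else 0) + (2 * (Fintype.card A : ℝ))⁻¹) := by
          refine Finset.sum_le_sum fun s _ => ?_
          simp only [r]
          split_ifs
          · have : 0 ≤ (2 * (Fintype.card A : ℝ))⁻¹ := by positivity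
            linarith
          · simp
      _ = 1 := by
          rw [Finset.sum_add_distrib]
          simp only [Finset.sum_ite_eq, Finset.mem_univ, if_true, Finset.sum_const,
            Finset.card_univ, nsmul_eq_mul]
          field_simp
          norm_num
  let q : A × B → ℝ := fun x => r x.1 x.2 * prob p W x.2
  have hq1 : ∑ x, q x ≤ 1 := by
    rw [Fintype.sum_prod_type_right, ← sum_prob hp W]
    refine Finset.sum_le_sum fun w _ => ?_
    simp only [q]
    rw [← Finset.sum_mul]
    exact mul_le_of_le_one_left (prob_nonneg hp _ _) (hrs w)
  have gg := gibbs hp (fun ω => (S ω, W ω)) q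
    (fun x => mul_nonneg (hr _ _).le (prob_nonneg hp _ _)) hq1
    (fun ω h => mul_pos (hr _ _) (h.trans_le (le_prob hp W ω)))
  have e : -∑ ω, p ω * Real.logb 2 (q (S ω, W ω)) = ent p W +
      (1 + (∑ ω, Set.indicator {ω | g (W ω) ≠ S ω} p ω) * Real.logb 2 (Fintype.card A)) := by
    rw [ent_eq, ← hp.2, Finset.sum_mul, ← Finset.sum_add_distrib, neg_add_eq_sub,
      ← Finset.sum_sub_distrib, ← Finset.sum_neg_distrib]
    refine Finset.sum_congr rfl fun ω _ => ?_
    rcases (hp.1 ω).eq_or_lt with h0 | h0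
    · simp [← h0, Set.indicator]
    · have h1 := h0.trans_le (le_prob hp W ω)
      simp only [q]
      rw [Real.logb_mul (hr _ _).ne' h1.ne']
      simp only [r]
      have l2 : Real.logb 2 2 = 1 := Real.logb_self_eq_one (by norm_num)
      by_cases h : g (W ω) = S ω
      · simp only [h, if_true, Set.indicator, Set.mem_setOf_eq, ne_eq, not_true_eq_false, if_false]
        rw [one_div, Real.logb_inv, l2]
        ring
      · simp only [h, if_false, Set.indicator, Set.mem_setOf_eq, ne_eq, not_false_eq_true, if_true]
        rw [Real.logb_inv, Real.logb_mul (by norm_num) hc.ne', l2]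
        ring
  have hlog : 0 ≤ Real.logb 2 (Fintype.card A) :=
    Real.logb_nonneg (by norm_num) (by exact_mod_cast Fintype.card_pos)
  have := mul_le_mul_of_nonneg_right hPe hlog
  linarith

end Aux

section Block

variable {L D : ℕ} {𝒳 : Fin L → Type} {𝒴 : Fin D → Type}
variable [∀ l, Fintype (𝒳 l)] [∀ d, Fintype (𝒴 d)]

lemma sum_prod_fn {α : Type*} [Fintype α] (n : ℕ) (h : Fin n → α → ℝ) :
    ∑ ω : Fin n → α, ∏ i, h i (ω i) = ∏ i, ∑ a, h i a := by
  rw [Finset.prod_univ_sum]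
  simp

lemma iid_pmf {p : Base 𝒳 𝒴 → ℝ} (hp : IsPMF p) (n : ℕ) : IsPMF (iid p n) := by
  refine ⟨fun ω => Finset.prod_nonneg fun i _ => hp.1 _, ?_⟩
  unfold iid
  rw [sum_prod_fn n (fun _ => p)]
  simp [hp.2]

/-- Blockwise extension of a single-letter random variable. -/
def blk {A : Type*} (n : ℕ) (f : Base 𝒳 𝒴 → A) : (Fin n → Base 𝒳 𝒴) → Fin n → A :=
  fun ω i => f (ω i)

lemma prob_blk (p : Base 𝒳 𝒴 → ℝ) (n : ℕ) {A : Type*} (f : Base 𝒳 𝒴 → A) (a : Fin n → A) :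
    prob (iid p n) (blk n f) a = ∏ i, prob p f (a i) := by
  unfold prob
  rw [← sum_prod_fn n (fun i b => if f b = a i then p b else 0)]
  refine Finset.sum_congr rfl fun ω _ => ?_
  by_cases h : blk n f ω = a
  · rw [if_pos h]
    subst h
    simp [blk, iid]
  · rw [if_neg h]
    obtain ⟨i, hi⟩ := Function.ne_iff.1 h
    exact (Finset.prod_eq_zero (Finset.mem_univ i) (if_neg hi)).symm

lemma sum_iid {p : Base 𝒳 𝒴 → ℝ} (hp : IsPMF p) (n : ℕ) (g : Base 𝒳 𝒴 → ℝ) (i : Fin n) :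
    ∑ ω, iid p n ω * g (ω i) = ∑ b, p b * g b := by
  have h1 : ∀ ω : Fin n → Base 𝒳 𝒴, iid p n ω * g (ω i) =
      ∏ j, (p (ω j) * if j = i then g (ω j) else 1) := by
    intro ω
    rw [Finset.prod_mul_distrib]
    simp [iid]
  simp_rw [h1]
  rw [sum_prod_fn n (fun j b => p b * if j = i then g b else 1)]
  rw [Finset.prod_eq_single i]
  · simp
  · intro j _ hj
    simp [hj, hp.2]
  · simp

lemma ent_blk {p : Base 𝒳 𝒴 → ℝ} (hp : IsPMF p) (n : ℕ) {A : Type*} [Fintype A]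
    (f : Base 𝒳 𝒴 → A) : ent (iid p n) (blk n f) = n * ent p f := by
  rw [ent_eq, ent_eq]
  have h1 : ∀ ω : Fin n → Base 𝒳 𝒴,
      iid p n ω * Real.logb 2 (prob (iid p n) (blk n f) (blk n f ω)) =
      ∑ i, iid p n ω * Real.logb 2 (prob p f (f (ω i))) := by
    intro ω
    rcases ((iid_pmf hp n).1 ω).eq_or_lt with h0 | h0
    · simp [← h0]
    · rw [prob_blk, ← Finset.mul_sum]
      congr 1
      unfold Real.logb
      rw [Real.log_prod, Finset.sum_div]
      · rfl
      · intro i _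
        have : p (ω i) ≠ 0 := by
          intro h
          exact h0.ne' (Finset.prod_eq_zero (Finset.mem_univ i) h)
        exact (((hp.1 _).lt_of_ne' this).trans_le (le_prob hp f (ω i))).ne'
  simp_rw [h1]
  rw [Finset.sum_comm]
  simp_rw [sum_iid hp n (fun b => Real.logb 2 (prob p f (f b)))]
  simp

lemma secCard_pos (R : Fin D → ℝ) (n : ℕ) (d : Fin D) : 0 < secCard R n d :=
  Nat.ceil_pos.2 (by positivity)

lemma le_log_secCard (R : Fin D → ℝ) (n : ℕ) (d : Fin D) :
    n * R d ≤ Real.logb 2 (secCard R n d) := by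
  rw [Real.le_logb_iff_rpow_le (by norm_num) (by exact_mod_cast secCard_pos R n d)]
  exact Nat.le_ceil _

lemma log_secCard_le (R : Fin D → ℝ) (hR : ∀ d, 0 ≤ R d) (n : ℕ) (d : Fin D) :
    Real.logb 2 (secCard R n d) ≤ n * R d + 1 := by
  rw [Real.logb_le_iff_le_rpow (by norm_num) (by exact_mod_cast secCard_pos R n d)]
  have h1 : (1:ℝ) ≤ 2 ^ ((n:ℝ) * R d) :=
    Real.one_le_rpow (by norm_num) (mul_nonneg (Nat.cast_nonneg _) (hR d))
  have h2 := (Nat.ceil_lt_add_one (a := (2:ℝ) ^ ((n:ℝ) * R d)) (by positivity)).le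
  rw [Real.rpow_add (by norm_num), Real.rpow_one]
  unfold secCard
  linarith

end Block

lemma limit_arg (R I c : ℝ) (e l u : ℕ → ℝ) (he : Tendsto e atTop (nhds 0))
    (hl : Tendsto l atTop (nhds 0)) (hu : Tendsto u atTop (nhds 0))
    (h : ∀ n : ℕ, n * R ≤ n * I + l n + u n + (1 + e n * (n * c + 2))) : R ≤ I := by
  have hinv : Tendsto (fun n : ℕ => ((n:ℝ))⁻¹) atTop (nhds 0) :=
    tendsto_inv_atTop_nhds_zero_nat
  have ht : Tendsto (fun n : ℕ => I + (l n + u n + 1 + e n * 2) * ((n:ℝ))⁻¹ + e n * c)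
      atTop (nhds (I + (0 + 0 + 1 + 0 * 2) * 0 + 0 * c)) :=
    ((((hl.add hu).add_const 1).add (he.mul_const 2)).mul hinv |>.const_add I).add
      (he.mul_const c)
  have : R ≤ I + (0 + 0 + 1 + 0 * 2) * 0 + 0 * c := by
    refine ge_of_tendsto ht ?_
    filter_upwards [eventually_gt_atTop 0] with n hn
    have hn' : (0:ℝ) < n := by exact_mod_cast hn
    have e1 : (I + (l n + u n + 1 + e n * 2) * ((n:ℝ))⁻¹ + e n * c) * n =
      n * I + l n + u n + (1 + e n * (n * c + 2)) := by
      field_simp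
      ring
    have := h n
    rw [← e1, mul_comm] at this
    exact le_of_mul_le_mul_right this hn'
  simpa using this

section Main

variable {L : ℕ} {𝒳 : Fin L → Type} {𝒴 : Fin 2 → Type}
variable [∀ l, Fintype (𝒳 l)] [∀ d, Fintype (𝒴 d)]
variable {R : Fin 2 → ℝ} {n : ℕ}

lemma blk_eq_iff {A : Type*} (f : Base 𝒳 𝒴 → A) (ω ω' : Fin n → Base 𝒳 𝒴) :
    blk n f ω = blk n f ω' ↔ ∀ i, f (ω i) = f (ω' i) := funext_iff

lemma XTn_eq_iff (T : Finset (Fin L)) (ω ω' : Fin n → Base 𝒳 𝒴) :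
    XTn T n ω = XTn T n ω' ↔ ∀ i, ∀ l ∈ T, (ω i).1 l = (ω' i).1 l := by
  constructor
  · intro h i l hl
    exact congrFun (congrFun h ⟨l, hl⟩) i
  · intro h
    funext l i
    exact h i l.1 l.2

lemma XT_eq_iff (T : Finset (Fin L)) (ω ω' : Base 𝒳 𝒴) :
    XT T ω = XT T ω' ↔ ∀ l ∈ T, ω.1 l = ω'.1 l := by
  constructor
  · intro h l hl
    exact congrFun h ⟨l, hl⟩
  · intro h
    funext l
    exact h l.1 l.2

lemma Mrv_eq {𝔸 : Set (Finset (Fin L))} (σ : Strategy 𝒳 𝒴 𝔸 R n) (d : Fin 2)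
    (ω ω' : Fin n → Base 𝒳 𝒴) (h : ∀ i, (ω i).2 d = (ω' i).2 d) :
    σ.Mrv ω d = σ.Mrv ω' d := by
  unfold Strategy.Mrv
  simp_rw [h]

lemma Srv_eq {𝔸 : Set (Finset (Fin L))} (σ : Strategy 𝒳 𝒴 𝔸 R n) (d : Fin 2)
    (ω ω' : Fin n → Base 𝒳 𝒴) (h : ∀ i, (ω i).2 d = (ω' i).2 d) :
    σ.Srv ω d = σ.Srv ω' d := by
  unfold Strategy.Srv
  simp_rw [h]

lemma block_sum (hR : ∀ d, 0 ≤ R d) {p : Base 𝒳 𝒴 → ℝ} (hp : IsPMF p)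
    (σ : Strategy 𝒳 𝒴 {Finset.univ} R n) (T : Finset (Fin L)) :
    n * (R 0 + R 1) ≤ n * condMutInf p (fun ω => ω.2) (XT Finset.univ) (XT T) +
      σ.leak p T + σ.unif p + (1 + σ.err p Finset.univ (Set.mem_singleton _) * (n * (R 0 + R 1) + 2)) := by
  have hP := iid_pmf hp n
  have : ∀ d, Nonempty (Fin (secCard R n d)) := fun d => ⟨⟨0, secCard_pos R n d⟩⟩
  have hF := fano hP σ.Srv (fun ω => (σ.Mrv ω, XTn Finset.univ n ω))
    (fun w => σ.dec Finset.univ (Set.mem_singleton _) w.2 w.1)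
    (σ.err p Finset.univ (Set.mem_singleton _)) (by
      unfold Strategy.err
      refine Finset.sum_le_sum fun ω _ => ?_
      by_cases h : σ.ShatRv Finset.univ (Set.mem_singleton _) ω = σ.Srv ω
      · rw [if_neg (fun h' => h' h)]
        exact le_of_eq (Set.indicator_of_notMem (Set.notMem_setOf_iff.2 (fun h' => h' h)) _)
      · rw [if_pos h]
        exact Set.indicator_le_self' (fun ω _ => hP.1 ω) ω)
  have hcard : Real.logb 2 (Fintype.card (∀ d, Fin (secCard R n d))) =
      Real.logb 2 (secCard R n 0) + Real.logb 2 (secCard R n 1) := by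
    rw [Fintype.card_pi, Fin.prod_univ_two, Fintype.card_fin, Fintype.card_fin, Nat.cast_mul,
      Real.logb_mul] <;> exact_mod_cast (secCard_pos R n _).ne'
  have herr0 : 0 ≤ σ.err p Finset.univ (Set.mem_singleton _) := by
    unfold Strategy.err
    refine Finset.sum_nonneg fun ω _ => ?_
    split_ifs
    · exact hP.1 ω
    · exact le_rfl
  rw [hcard] at hF
  have hc0 := log_secCard_le R hR n 0
  have hc1 := log_secCard_le R hR n 1
  have hb0 := le_log_secCard R n 0
  have hb1 := le_log_secCard R n 1
  have hE := mul_le_mul_of_nonneg_left (add_le_add hc0 hc1) herr0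
  have hu : σ.unif p = Real.logb 2 (secCard R n 0) + Real.logb 2 (secCard R n 1) -
      ent (iid p n) σ.Srv := by
    unfold Strategy.unif
    rw [Fin.prod_univ_two, Real.logb_mul] <;> exact_mod_cast (secCard_pos R n _).ne'
  have hI : n * condMutInf p (fun ω => ω.2) (XT Finset.univ) (XT T) =
      (ent (iid p n) (blk n fun ω => (ω.2, XT T ω)) - ent (iid p n) (blk n (XT T))) -
      (ent (iid p n) (blk n fun ω => (ω.2, XT Finset.univ ω, XT T ω)) -
        ent (iid p n) (blk n fun ω => (XT Finset.univ ω, XT T ω))) := by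
    simp only [ent_blk hp, condMutInf, condEnt]
    ring
  have s1 := submod hP (blk n fun ω => (ω.2, XT T ω))
    (fun ω => (σ.Srv ω, σ.Mrv ω, XTn Finset.univ n ω))
    (blk n fun ω => (ω.2, XT Finset.univ ω, XT T ω))
    (fun ω => (σ.Srv ω, σ.Mrv ω, XTn T n ω))
    (by
      intro ω ω' h
      simp only [blk_eq_iff, Prod.mk.injEq, XT_eq_iff, XTn_eq_iff] at h ⊢
      exact ⟨funext fun d => Srv_eq σ d _ _ fun i => congrFun (h i).1 d,
        funext fun d => Mrv_eq σ d _ _ fun i => congrFun (h i).1 d, fun i => (h i).2⟩)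
    (by
      intro ω ω' h
      simp only [Prod.mk.injEq, XTn_eq_iff] at h ⊢
      exact ⟨h.1, h.2.1, fun i l _ => h.2.2 i l (Finset.mem_univ _)⟩)
    (by
      intro ω ω' h h'
      simp only [blk_eq_iff, Prod.mk.injEq, XT_eq_iff, XTn_eq_iff] at h h' ⊢
      exact fun i => ⟨(h i).1, h'.2.2 i, (h i).2⟩)
  have s2 := submod hP (fun ω => (σ.Mrv ω, XTn T n ω))
    (blk n fun ω => (XT Finset.univ ω, XT T ω))
    (fun ω => (σ.Mrv ω, XTn Finset.univ n ω))
    (blk n (XT T))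
    (by
      intro ω ω' h
      simp only [blk_eq_iff, Prod.mk.injEq, XT_eq_iff, XTn_eq_iff] at h ⊢
      exact h.2)
    (by
      intro ω ω' h
      simp only [blk_eq_iff, Prod.mk.injEq, XT_eq_iff] at h ⊢
      exact fun i => (h i).2)
    (by
      intro ω ω' h h'
      simp only [blk_eq_iff, Prod.mk.injEq, XT_eq_iff, XTn_eq_iff] at h h' ⊢
      exact ⟨h.1, fun i => (h' i).1⟩)
  have hl : σ.leak p T = ent (iid p n) σ.Srv + ent (iid p n) (fun ω => (σ.Mrv ω, XTn T n ω)) -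
      ent (iid p n) (fun ω => (σ.Srv ω, σ.Mrv ω, XTn T n ω)) := rfl
  rw [hI, hl, hu]
  linarith

lemma block_one (hR : ∀ d, 0 ≤ R d) {p : Base 𝒳 𝒴 → ℝ} (hp : IsPMF p)
    (σ : Strategy 𝒳 𝒴 {Finset.univ} R n) (T : Finset (Fin L)) (d e : Fin 2)
    (hde : ∀ i, i = d ∨ i = e)
    (hsum : Real.logb 2 (∏ i, (secCard R n i : ℝ)) =
      Real.logb 2 (secCard R n d) + Real.logb 2 (secCard R n e)) :
    n * R d ≤ n * condMutInf p (fun ω => ω.2 d)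
        (fun ω => (XT Finset.univ ω, ω.2 e)) (XT T) +
      σ.leak p T + σ.unif p + (1 + σ.err p Finset.univ (Set.mem_singleton _) * (n * R d + 2)) := by
  have hP := iid_pmf hp n
  have : ∀ d, Nonempty (Fin (secCard R n d)) := fun d => ⟨⟨0, secCard_pos R n d⟩⟩
  have hF := fano hP (fun ω => σ.Srv ω d)
    (fun ω => (σ.Mrv ω, XTn Finset.univ n ω, blk n (fun ω => ω.2 e) ω))
    (fun w => σ.dec Finset.univ (Set.mem_singleton _) w.2.1 w.1 d)
    (σ.err p Finset.univ (Set.mem_singleton _)) (by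
      unfold Strategy.err
      refine Finset.sum_le_sum fun ω _ => ?_
      by_cases h : σ.ShatRv Finset.univ (Set.mem_singleton _) ω = σ.Srv ω
      · rw [if_neg (fun h' => h' h)]
        exact le_of_eq (Set.indicator_of_notMem (Set.notMem_setOf_iff.2 (fun h' => h' (congrFun h d))) _)
      · rw [if_pos h]
        exact Set.indicator_le_self' (fun ω _ => hP.1 ω) ω)
  have herr0 : 0 ≤ σ.err p Finset.univ (Set.mem_singleton _) := by
    unfold Strategy.err
    refine Finset.sum_nonneg fun ω _ => ?_
    split_ifs
    · exact hP.1 ω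
    · exact le_rfl
  simp only [Fintype.card_fin] at hF
  have hc := log_secCard_le R hR n d
  have hb := le_log_secCard R n d
  have hb0 : 0 ≤ Real.logb 2 (secCard R n d) :=
    le_trans (mul_nonneg (Nat.cast_nonneg _) (hR d)) hb
  have hE := mul_le_mul_of_nonneg_left (hc.trans (by linarith : _ ≤ n * R d + 2)) herr0
  have hse := ent_le_log_card hP (fun ω => σ.Srv ω e)
  rw [Fintype.card_fin] at hse
  have hadd := submod hP (fun ω => σ.Srv ω d) (fun ω => σ.Srv ω e) σ.Srv (fun _ => ())
    (fun _ _ _ => rfl) (fun _ _ _ => rfl)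
    (fun ω ω' h h' => funext fun i => by
      rcases hde i with rfl | rfl
      · exact h
      · exact h')
  have hunit : 0 ≤ ent (iid p n) (fun _ => ()) := by
    have := ent_eq (iid p n) (fun _ => ())
    rw [this]
    simp [prob, hP.2]
  have hI : n * condMutInf p (fun ω => ω.2 d)
        (fun ω => (XT Finset.univ ω, ω.2 e)) (XT T) =
      (ent (iid p n) (blk n fun ω => (ω.2 d, XT T ω)) - ent (iid p n) (blk n (XT T))) -
      (ent (iid p n) (blk n fun ω => (ω.2 d, (XT Finset.univ ω, ω.2 e), XT T ω)) -
        ent (iid p n) (blk n fun ω => ((XT Finset.univ ω, ω.2 e), XT T ω))) := by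
    simp only [ent_blk hp, condMutInf, condEnt]
    ring
  have hM : ∀ ω ω' : Fin n → Base 𝒳 𝒴, σ.Mrv ω d = σ.Mrv ω' d → σ.Mrv ω e = σ.Mrv ω' e →
      σ.Mrv ω = σ.Mrv ω' := fun ω ω' h h' => funext fun i => by
    rcases hde i with rfl | rfl
    · exact h
    · exact h'
  have s0 := submod hP σ.Srv (fun ω => (σ.Srv ω d, σ.Mrv ω, XTn T n ω))
    (fun ω => (σ.Srv ω, σ.Mrv ω, XTn T n ω)) (fun ω => σ.Srv ω d)
    (fun ω ω' h => congrFun h d)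
    (fun ω ω' h => by
      simp only [Prod.mk.injEq] at h
      exact h.1)
    (fun ω ω' h h' => by
      simp only [Prod.mk.injEq] at h' ⊢
      exact ⟨h, h'.2⟩)
  have s1 := submod hP (fun ω => (blk n (fun ω => (ω.2 d, XT T ω)) ω, σ.Mrv ω e))
    (fun ω => (σ.Srv ω d, σ.Mrv ω, XTn Finset.univ n ω, blk n (fun ω => ω.2 e) ω))
    (blk n fun ω => (ω.2 d, (XT Finset.univ ω, ω.2 e), XT T ω))
    (fun ω => (σ.Srv ω d, σ.Mrv ω, XTn T n ω))
    (by
      intro ω ω' h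
      simp only [blk_eq_iff, Prod.mk.injEq, XT_eq_iff, XTn_eq_iff] at h ⊢
      exact ⟨Srv_eq σ d _ _ fun i => (h.1 i).1,
        hM _ _ (Mrv_eq σ d _ _ fun i => (h.1 i).1) h.2, fun i => (h.1 i).2⟩)
    (by
      intro ω ω' h
      simp only [Prod.mk.injEq, XTn_eq_iff] at h ⊢
      exact ⟨h.1, h.2.1, fun i l _ => h.2.2.1 i l (Finset.mem_univ _)⟩)
    (by
      intro ω ω' h h'
      simp only [blk_eq_iff, Prod.mk.injEq, XT_eq_iff, XTn_eq_iff] at h h' ⊢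
      exact fun i => ⟨(h.1 i).1, ⟨h'.2.2.1 i, h'.2.2.2 i⟩, (h.1 i).2⟩)
  have s2 := submod hP (fun ω => (σ.Mrv ω, XTn T n ω))
    (blk n fun ω => ((XT Finset.univ ω, ω.2 e), XT T ω))
    (fun ω => (σ.Mrv ω, XTn Finset.univ n ω, blk n (fun ω => ω.2 e) ω))
    (fun ω => (σ.Mrv ω e, XTn T n ω))
    (by
      intro ω ω' h
      simp only [Prod.mk.injEq] at h ⊢
      exact ⟨congrFun h.1 e, h.2⟩)
    (by
      intro ω ω' h
      simp only [blk_eq_iff, Prod.mk.injEq, XT_eq_iff, XTn_eq_iff] at h ⊢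
      exact ⟨Mrv_eq σ e _ _ fun i => (h i).1.2, fun i => (h i).2⟩)
    (by
      intro ω ω' h h'
      simp only [blk_eq_iff, Prod.mk.injEq, XT_eq_iff, XTn_eq_iff] at h h' ⊢
      exact ⟨h.1, fun i => (h' i).1.1, fun i => (h' i).1.2⟩)
  have s3 := submod hP (blk n fun ω => (ω.2 d, XT T ω))
    (fun ω => (σ.Mrv ω e, XTn T n ω))
    (fun ω => (blk n (fun ω => (ω.2 d, XT T ω)) ω, σ.Mrv ω e))
    (blk n (XT T))
    (by
      intro ω ω' h
      simp only [blk_eq_iff, Prod.mk.injEq, XT_eq_iff] at h ⊢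
      exact fun i => (h i).2)
    (by
      intro ω ω' h
      simp only [blk_eq_iff, Prod.mk.injEq, XT_eq_iff, XTn_eq_iff] at h ⊢
      exact h.2)
    (by
      intro ω ω' h h'
      simp only [Prod.mk.injEq] at h' ⊢
      exact ⟨h, h'.1⟩)
  have hl : σ.leak p T = ent (iid p n) σ.Srv + ent (iid p n) (fun ω => (σ.Mrv ω, XTn T n ω)) -
      ent (iid p n) (fun ω => (σ.Srv ω, σ.Mrv ω, XTn T n ω)) := rfl
  rw [hI, hl, Strategy.unif, hsum]
  linarith

end Main

/-- **Corollary 5 (Outer bound, `D = 2`, all-or-nothing access structure).** -/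
theorem outer_bound_two_dealers_all_or_nothing
    {L : ℕ} (hL : 1 ≤ L)
    {𝒳 : Fin L → Type} {𝒴 : Fin 2 → Type}
    [∀ l, Fintype (𝒳 l)] [∀ l, Nonempty (𝒳 l)]
    [∀ d, Fintype (𝒴 d)] [∀ d, Nonempty (𝒴 d)]
    (p : Base 𝒳 𝒴 → ℝ) (hp : IsPMF p)
    (R : Fin 2 → ℝ)
    (hach : Achievable p {Finset.univ} {U : Finset (Fin L) | U ≠ Finset.univ} R) :
    ∀ T : Finset (Fin L), T ≠ Finset.univ →
      R 0 ≤ condMutInf p (fun ω => ω.2 0)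
              (fun ω => (XT Finset.univ ω, ω.2 1)) (XT T) ∧
      R 1 ≤ condMutInf p (fun ω => ω.2 1)
              (fun ω => (XT Finset.univ ω, ω.2 0)) (XT T) ∧
      R 0 + R 1 ≤ condMutInf p (fun ω => ω.2) (XT Finset.univ) (XT T) := by
  obtain ⟨hR, σ, he, hl, hu⟩ := hach
  intro T hT
  have he' := he Finset.univ (Set.mem_singleton _)
  have hl' := hl T hT
  have hs : ∀ n, Real.logb 2 (∏ i, (secCard R n i : ℝ)) =
      Real.logb 2 (secCard R n 0) + Real.logb 2 (secCard R n 1) := fun n => by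
    rw [Fin.prod_univ_two, Real.logb_mul] <;> exact_mod_cast (secCard_pos R n _).ne'
  refine ⟨limit_arg _ _ (R 0) _ _ _ he' hl' hu fun n => ?_,
    limit_arg _ _ (R 1) _ _ _ he' hl' hu fun n => ?_,
    limit_arg _ _ (R 0 + R 1) _ _ _ he' hl' hu fun n => block_sum hR hp (σ n) T⟩
  · exact block_one hR hp (σ n) T 0 1 (fun i => by fin_cases i <;> simp) (hs n)
  · exact block_one hR hp (σ n) T 1 0 (fun i => by fin_cases i <;> simp)
      ((hs n).trans (add_comm _ _))

end SecretSharing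
end
end

section
/- Distributed leftover hash lemma (Lemma 1): let ℒ = {1,…,L}, let 𝒳_l (l ∈ ℒ) and 𝒵 be finite alphabets, and let p_{X_ℒ Z} be a sub-normalized nonnegative function on (∏_{l∈ℒ} 𝒳_l) × 𝒵. For each l ∈ ℒ let ℱ_l be a two-universal family of functions 𝒳_l → {0,1}^{r_l}, and let F_l be uniformly distributed on ℱ_l, independently across l and independently of (X_ℒ, Z). Write F_ℒ = (F_l)_{l∈ℒ}, F_ℒ(X_ℒ) = (F_l(X_l))_{l∈ℒ}, and r_S = Σ_{l∈S} r_l for S ⊆ ℒ, and let p_{F_ℒ(X_ℒ) F_ℒ Z} denote the induced sub-normalized function on (∏_{l∈ℒ}{0,1}^{r_l}) × (∏_{l∈ℒ}ℱ_l) × 𝒵. Then for every pmf q_Z on 𝒵 with supp(p_Z) ⊆ supp(q_Z) (p_Z the marginal of p_{X_ℒ Z} on 𝒵): V( p_{F_ℒ(X_ℒ) F_ℒ Z}, p_{U_K} · p_{U_F} · p_Z ) ≤ sqrt( Σ_{∅ ≠ S ⊆ ℒ} 2^{ r_S − H∞(p_{X_S Z} | q_Z) } ), where p_{U_K} and p_{U_F}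 are the uniform pmfs on ∏_{l∈ℒ}{0,1}^{r_l} and on ∏_{l∈ℒ}ℱ_l respectively, and p_{X_S Z} is the marginal of p_{X_ℒ Z} on (∏_{l∈S}𝒳_l) × 𝒵. -/
open scoped BigOperators
open Finset Filter

noncomputable section

namespace SecretSharing

open scoped Classical

/-! ### Basic Shannon information quantities (base 2) on finite probability spaces -/

variable {Ω : Type*} [Fintype Ω]

/-- Conditional min-entropy `H∞(w | q) = −log₂ max_{a, z ∈ supp(q)} w(a,z)/q(z)`
of a (sub-normalized nonnegative) joint function `w` given a pmf `q`. -/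
def condMinEnt {A Z : Type*} (w : A → Z → ℝ) (q : Z → ℝ) : ℝ :=
  - Real.logb 2 (sSup {y : ℝ | ∃ a z, q z ≠ 0 ∧ y = w a z / q z})

/-- Min-entropy `H∞(w) = −log₂ max w`. -/
def minEnt {A : Type*} (w : A → ℝ) : ℝ :=
  - Real.logb 2 (sSup (Set.range w))

/-- A family `F` of hash functions (given by the evaluation map `ev`) from `A`
to `{0,1}^r` is two-universal: for `x ≠ x'`, a uniformly chosen member collides
on `x, x'` with probability at most `2^{-r}`. -/
def TwoUniversal {A : Type*} (F : Type*) [Fintype F] {r : ℕ}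
    (ev : F → A → (Fin r → Bool)) : Prop :=
  ∀ x x' : A, x ≠ x' →
    ((Finset.univ.filter (fun f : F => ev f x = ev f x')).card : ℝ)
        / (Fintype.card F : ℝ)
      ≤ ((2 : ℝ) ^ r)⁻¹

lemma prod_collision_le
    {L : ℕ} {𝒳 : Fin L → Type}
    (r : Fin L → ℕ) (F : Fin L → Type) [∀ l, Fintype (F l)] [∀ l, Nonempty (F l)]
    (ev : ∀ l, F l → 𝒳 l → (Fin (r l) → Bool))
    (huniv : ∀ l, TwoUniversal (F l) (ev l)) (x x' : ∀ l, 𝒳 l) :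
    (∏ l, (2 : ℝ) ^ (r l)) * ((∏ l, (Fintype.card (F l) : ℝ))⁻¹ *
      ∑ f : ∀ l, F l, if ∀ l, ev l (f l) (x l) = ev l (f l) (x' l) then (1 : ℝ) else 0)
    ≤ ∑ S : Finset (Fin L), (∏ l ∈ S, (2 : ℝ) ^ (r l)) *
        (if ∀ l ∈ S, x' l = x l then (1 : ℝ) else 0) := by
  have h1 : (∑ f : ∀ l, F l, if ∀ l, ev l (f l) (x l) = ev l (f l) (x' l) then (1 : ℝ) else 0)
      = ∏ l, ∑ f : F l, if ev l f (x l) = ev l f (x' l) then (1 : ℝ) else 0 := by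
    rw [Finset.prod_univ_sum, Fintype.piFinset_univ]
    refine Finset.sum_congr rfl fun f _ => ?_
    rw [Finset.prod_ite_zero]
    simp
  have h2 : ∀ S : Finset (Fin L), (∏ l ∈ S, (2 : ℝ) ^ (r l)) *
        (if ∀ l ∈ S, x' l = x l then (1 : ℝ) else 0)
      = ∏ l ∈ S, ((2 : ℝ) ^ (r l) * if x' l = x l then (1 : ℝ) else 0) := by
    intro S
    rw [Finset.prod_mul_distrib, Finset.prod_ite_zero]
    simp
  simp_rw [h2]
  rw [h1, ← Finset.prod_inv_distrib, ← Finset.prod_mul_distrib, ← Finset.prod_mul_distrib,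
    ← Finset.powerset_univ, ← Finset.prod_one_add]
  refine Finset.prod_le_prod (fun l _ => ?_) (fun l _ => ?_)
  · refine mul_nonneg (by positivity) (mul_nonneg (by positivity) ?_)
    exact Finset.sum_nonneg fun f _ => by split_ifs <;> norm_num
  · have hN : (0 : ℝ) < Fintype.card (F l) := by exact_mod_cast Fintype.card_pos
    have hK : (0 : ℝ) < 2 ^ (r l) := by positivity
    by_cases hx : x' l = x l
    · simp only [hx, if_true, Finset.sum_const, Finset.card_univ, nsmul_eq_mul, mul_one]
      rw [inv_mul_cancel₀ hN.ne']
      linarith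
    · have := huniv l (x l) (x' l) (fun h => hx h.symm)
      simp only [hx, if_false, mul_zero, add_zero, Finset.sum_boole]
      rw [div_eq_inv_mul] at this
      calc _ ≤ (2 : ℝ) ^ (r l) * ((2 : ℝ) ^ (r l))⁻¹ := by gcongr
        _ = 1 := mul_inv_cancel₀ hK.ne'

lemma sum_sq_le
    {L : ℕ} {𝒳 : Fin L → Type} [∀ l, Fintype (𝒳 l)]
    (r : Fin L → ℕ) (F : Fin L → Type) [∀ l, Fintype (F l)] [∀ l, Nonempty (F l)]
    (ev : ∀ l, F l → 𝒳 l → (Fin (r l) → Bool))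
    (huniv : ∀ l, TwoUniversal (F l) (ev l)) (g : (∀ l, 𝒳 l) → ℝ) (hg : ∀ x, 0 ≤ g x) :
    (∏ l, (2 : ℝ) ^ (r l)) * ((∏ l, (Fintype.card (F l) : ℝ))⁻¹ *
      ∑ f : ∀ l, F l, ∑ k : ∀ l, Fin (r l) → Bool,
        ((∑ x : ∀ l, 𝒳 l, if ∀ l, ev l (f l) (x l) = k l then g x else 0)
          - (∏ l, (2 : ℝ) ^ (r l))⁻¹ * ∑ x, g x) ^ 2)
    ≤ ∑ S : Finset (Fin L), if S.Nonempty then (∏ l ∈ S, (2 : ℝ) ^ (r l)) *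
        ∑ x : ∀ l, 𝒳 l, g x * ∑ x' : ∀ l, 𝒳 l, if ∀ l ∈ S, x' l = x l then g x' else 0
      else 0 := by
  set K : ℝ := ∏ l, (2 : ℝ) ^ (r l) with hK
  set N : ℝ := ∏ l, (Fintype.card (F l) : ℝ) with hN
  set P : ℝ := ∑ x, g x with hP
  have hKpos : 0 < K := Finset.prod_pos fun l _ => by positivity
  have hNpos : 0 < N := Finset.prod_pos fun l _ => by exact_mod_cast Fintype.card_pos
  have hcardK : (Fintype.card (∀ l, Fin (r l) → Bool) : ℝ) = K := by
    simp [hK, Fintype.card_pi]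
  have hcardN : (Fintype.card (∀ l, F l) : ℝ) = N := by
    simp [hN, Fintype.card_pi]
  have hsum : ∀ f : ∀ l, F l, ∑ k : ∀ l, Fin (r l) → Bool,
      (∑ x : ∀ l, 𝒳 l, if ∀ l, ev l (f l) (x l) = k l then g x else 0) = P := by
    intro f
    rw [Finset.sum_comm]
    refine Finset.sum_congr rfl fun x _ => ?_
    simp_rw [← funext_iff (f := fun l => ev l (f l) (x l))]
    simp
  have hsq : ∀ f : ∀ l, F l, ∑ k : ∀ l, Fin (r l) → Bool,
      (∑ x : ∀ l, 𝒳 l, if ∀ l, ev l (f l) (x l) = k l then g x else 0) ^ 2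
      = ∑ x : ∀ l, 𝒳 l, ∑ x' : ∀ l, 𝒳 l, g x * g x' *
        if ∀ l, ev l (f l) (x l) = ev l (f l) (x' l) then (1 : ℝ) else 0 := by
    intro f
    simp_rw [sq, Finset.sum_mul_sum]
    rw [Finset.sum_comm]
    refine Finset.sum_congr rfl fun x _ => ?_
    rw [Finset.sum_comm]
    refine Finset.sum_congr rfl fun x' _ => ?_
    rw [Finset.sum_eq_single (fun l => ev l (f l) (x l))]
    · simp [eq_comm]
    · intro k _ hk
      rw [if_neg (fun h => hk (funext fun l => (h l).symm)), zero_mul]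
    · simp
  have hvar : ∀ f : ∀ l, F l, ∑ k : ∀ l, Fin (r l) → Bool,
        ((∑ x : ∀ l, 𝒳 l, if ∀ l, ev l (f l) (x l) = k l then g x else 0)
          - K⁻¹ * P) ^ 2 = (∑ x : ∀ l, 𝒳 l, ∑ x' : ∀ l, 𝒳 l, g x * g x' *
        if ∀ l, ev l (f l) (x l) = ev l (f l) (x' l) then (1 : ℝ) else 0) - K⁻¹ * P ^ 2 := by
    intro f
    simp_rw [sub_sq, Finset.sum_add_distrib, Finset.sum_sub_distrib]
    rw [hsq, ← Finset.sum_mul, ← Finset.mul_sum, hsum, Finset.sum_const, Finset.card_univ,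
      nsmul_eq_mul, hcardK]
    field_simp
    ring
  simp_rw [hvar]
  rw [Finset.sum_sub_distrib, Finset.sum_const, Finset.card_univ, nsmul_eq_mul, hcardN]
  have hmain : K * (N⁻¹ * ∑ f : ∀ l, F l, ∑ x : ∀ l, 𝒳 l, ∑ x' : ∀ l, 𝒳 l, g x * g x' *
        if ∀ l, ev l (f l) (x l) = ev l (f l) (x' l) then (1 : ℝ) else 0)
      ≤ ∑ S : Finset (Fin L), (∏ l ∈ S, (2 : ℝ) ^ (r l)) *
        ∑ x : ∀ l, 𝒳 l, g x * ∑ x' : ∀ l, 𝒳 l, if ∀ l ∈ S, x' l = x l then g x' else 0 := by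
    calc _ = ∑ x : ∀ l, 𝒳 l, ∑ x' : ∀ l, 𝒳 l, g x * g x' * (K * (N⁻¹ * ∑ f : ∀ l, F l,
          if ∀ l, ev l (f l) (x l) = ev l (f l) (x' l) then (1 : ℝ) else 0)) := by
          rw [Finset.sum_comm, Finset.mul_sum, Finset.mul_sum]
          refine Finset.sum_congr rfl fun x _ => ?_
          rw [Finset.sum_comm, Finset.mul_sum, Finset.mul_sum]
          refine Finset.sum_congr rfl fun x' _ => ?_
          rw [← Finset.mul_sum]
          ring
      _ ≤ ∑ x : ∀ l, 𝒳 l, ∑ x' : ∀ l, 𝒳 l, g x * g x' *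
          ∑ S : Finset (Fin L), (∏ l ∈ S, (2 : ℝ) ^ (r l)) *
          (if ∀ l ∈ S, x' l = x l then (1 : ℝ) else 0) := by
          refine Finset.sum_le_sum fun x _ => Finset.sum_le_sum fun x' _ => ?_
          exact mul_le_mul_of_nonneg_left (prod_collision_le r F ev huniv x x')
            (mul_nonneg (hg x) (hg x'))
      _ = _ := by
          simp_rw [Finset.mul_sum]
          symm
          rw [Finset.sum_comm]
          refine Finset.sum_congr rfl fun x _ => ?_
          rw [Finset.sum_comm]
          refine Finset.sum_congr rfl fun x' _ => ?_
          refine Finset.sum_congr rfl fun S _ => ?_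
          split_ifs <;> ring
  have hempty : (∑ S : Finset (Fin L), (∏ l ∈ S, (2 : ℝ) ^ (r l)) *
        ∑ x : ∀ l, 𝒳 l, g x * ∑ x' : ∀ l, 𝒳 l, if ∀ l ∈ S, x' l = x l then g x' else 0)
      = (∑ S : Finset (Fin L), if S.Nonempty then (∏ l ∈ S, (2 : ℝ) ^ (r l)) *
        ∑ x : ∀ l, 𝒳 l, g x * ∑ x' : ∀ l, 𝒳 l, if ∀ l ∈ S, x' l = x l then g x' else 0
      else 0) + P ^ 2 := by
    have : P ^ 2 = ∑ S : Finset (Fin L), if S = ∅ then P ^ 2 else 0 := by simp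
    rw [this, ← Finset.sum_add_distrib]
    refine Finset.sum_congr rfl fun S _ => ?_
    rcases S.eq_empty_or_nonempty with rfl | hS
    · simp [← Finset.sum_mul, sq, ← hP]
    · simp [hS, hS.ne_empty]
  have e : K * (N⁻¹ * (N * (K⁻¹ * P ^ 2))) = P ^ 2 := by field_simp
  rw [mul_sub, mul_sub, e]
  linarith

lemma le_two_rpow_condMinEnt {A Z : Type*} [Finite A] [Finite Z] (w : A → Z → ℝ) (q : Z → ℝ)
    (hw : ∀ a z, 0 ≤ w a z) (hq0 : ∀ z, 0 ≤ q z) (R : ℝ) (a : A) (z : Z) (hz : q z ≠ 0) :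
    (2 : ℝ) ^ R * w a z ≤ (2 : ℝ) ^ (R - condMinEnt w q) * q z := by
  set T := {y : ℝ | ∃ a z, q z ≠ 0 ∧ y = w a z / q z} with hT
  have hfin : T.Finite := by
    refine (Set.finite_range (fun az : A × Z => w az.1 az.2 / q az.2)).subset ?_
    rintro y ⟨a, z, _, rfl⟩
    exact ⟨(a, z), rfl⟩
  have hle : w a z / q z ≤ sSup T := le_csSup hfin.bddAbove ⟨a, z, hz, rfl⟩
  have hqp : 0 < q z := lt_of_le_of_ne (hq0 z) hz.symm
  have h0 : 0 ≤ sSup T := le_trans (div_nonneg (hw a z) (hq0 z)) hle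
  have h2 : sSup T ≤ (2 : ℝ) ^ (- condMinEnt w q) := by
    rw [condMinEnt, neg_neg, ← hT]
    rcases h0.eq_or_lt with h | h
    · rw [← h]; positivity
    · rw [Real.rpow_logb (by norm_num) (by norm_num) h]
  rw [sub_eq_add_neg, Real.rpow_add (by norm_num), mul_assoc]
  refine mul_le_mul_of_nonneg_left ?_ (by positivity)
  rw [← div_le_iff₀ hqp]
  exact hle.trans h2

/-- **Lemma 1 (Distributed leftover hash lemma).** For a sub-normalized
nonnegative `p` on `(∏ l, 𝒳 l) × 𝒵`, independent uniformly chosen members `F_l`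
of two-universal families, and any pmf `q` on `𝒵` whose support contains that of
`p_Z`, the variational distance between the induced joint function
`p_{F_ℒ(X_ℒ) F_ℒ Z}` and `p_{U_K} · p_{U_F} · p_Z` is at most
`√(Σ_{∅ ≠ S ⊆ ℒ} 2^{r_S − H∞(p_{X_S Z} | q_Z)})`. -/
theorem distributed_leftover_hash
    {L : ℕ} {𝒳 : Fin L → Type} [∀ l, Fintype (𝒳 l)] [∀ l, Nonempty (𝒳 l)]
    {𝒵 : Type} [Fintype 𝒵] [Nonempty 𝒵]
    (p : ((∀ l, 𝒳 l) × 𝒵) → ℝ)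
    (hp0 : ∀ ω, 0 ≤ p ω) (hp1 : ∑ ω : (∀ l, 𝒳 l) × 𝒵, p ω ≤ 1)
    (r : Fin L → ℕ) (F : Fin L → Type) [∀ l, Fintype (F l)] [∀ l, Nonempty (F l)]
    (ev : ∀ l, F l → 𝒳 l → (Fin (r l) → Bool))
    (huniv : ∀ l, TwoUniversal (F l) (ev l))
    (q : 𝒵 → ℝ) (hq0 : ∀ z, 0 ≤ q z) (hq1 : ∑ z : 𝒵, q z = 1)
    (hsupp : ∀ z : 𝒵, (∑ x : ∀ l, 𝒳 l, p (x, z)) ≠ 0 → q z ≠ 0) :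
    ∑ k : ∀ l, Fin (r l) → Bool, ∑ f : ∀ l, F l, ∑ z : 𝒵,
      |(∏ l, (Fintype.card (F l) : ℝ))⁻¹ *
          (∑ x : ∀ l, 𝒳 l, if ∀ l, ev l (f l) (x l) = k l then p (x, z) else 0)
        - (Fintype.card (∀ l, Fin (r l) → Bool) : ℝ)⁻¹ *
            (Fintype.card (∀ l, F l) : ℝ)⁻¹ * (∑ x : ∀ l, 𝒳 l, p (x, z))|
    ≤ Real.sqrt (∑ S : Finset (Fin L),
        if S.Nonempty then
          (2 : ℝ) ^ ((∑ l ∈ S, (r l : ℝ)) -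
            condMinEnt
              (fun (xs : ∀ l : {l // l ∈ S}, 𝒳 l.1) (z : 𝒵) =>
                ∑ x : ∀ l, 𝒳 l,
                  if ∀ l : {l // l ∈ S}, x l.1 = xs l then p (x, z) else 0)
              q)
        else 0) := by
  set K : ℝ := ∏ l, (2 : ℝ) ^ (r l) with hK
  set N : ℝ := ∏ l, (Fintype.card (F l) : ℝ) with hN
  have hKpos : 0 < K := Finset.prod_pos fun l _ => by positivity
  have hNpos : 0 < N := Finset.prod_pos fun l _ => by exact_mod_cast Fintype.card_pos
  have hcardK : (Fintype.card (∀ l, Fin (r l) → Bool) : ℝ) = K := by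
    simp [hK, Fintype.card_pi]
  have hcardN : (Fintype.card (∀ l, F l) : ℝ) = N := by
    simp [hN, Fintype.card_pi]
  rw [hcardK, hcardN]
  set c : Finset (Fin L) → ℝ := fun S => (2 : ℝ) ^ ((∑ l ∈ S, (r l : ℝ)) -
            condMinEnt
              (fun (xs : ∀ l : {l // l ∈ S}, 𝒳 l.1) (z : 𝒵) =>
                ∑ x : ∀ l, 𝒳 l,
                  if ∀ l : {l // l ∈ S}, x l.1 = xs l then p (x, z) else 0)
              q) with hc
  have hc0 : ∀ S, 0 ≤ c S := fun S => by positivity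
  set B : ℝ := ∑ S : Finset (Fin L), if S.Nonempty then c S else 0 with hB
  have hB0 : 0 ≤ B := Finset.sum_nonneg fun S _ => by split_ifs <;> simp [hc0]
  set D : (∀ l, Fin (r l) → Bool) → (∀ l, F l) → 𝒵 → ℝ := fun k f z =>
    (∑ x : ∀ l, 𝒳 l, if ∀ l, ev l (f l) (x l) = k l then p (x, z) else 0)
      - K⁻¹ * ∑ x : ∀ l, 𝒳 l, p (x, z) with hD
  have hzero : ∀ z, q z = 0 → ∀ x, p (x, z) = 0 := by
    intro z hz x
    have h : ∑ x : ∀ l, 𝒳 l, p (x, z) = 0 := by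
      by_contra h
      exact hsupp z h hz
    exact (Finset.sum_eq_zero_iff_of_nonneg (fun x _ => hp0 (x, z))).1 h x (Finset.mem_univ x)
  have hcS : ∀ (S : Finset (Fin L)) (z : 𝒵) (x : ∀ l, 𝒳 l), (∏ l ∈ S, (2 : ℝ) ^ (r l)) *
      (∑ x' : ∀ l, 𝒳 l, if ∀ l ∈ S, x' l = x l then p (x', z) else 0) ≤ c S * q z := by
    intro S z x
    by_cases hz : q z = 0
    · simp [hzero z hz, hz]
    · have := le_two_rpow_condMinEnt (fun (xs : ∀ l : {l // l ∈ S}, 𝒳 l.1) (z : 𝒵) =>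
                ∑ x : ∀ l, 𝒳 l,
                  if ∀ l : {l // l ∈ S}, x l.1 = xs l then p (x, z) else 0) q
          (fun a z => Finset.sum_nonneg fun x _ => by split_ifs <;> simp [hp0]) hq0
          (∑ l ∈ S, (r l : ℝ)) (fun l => x l.1) z hz
      have e : (2 : ℝ) ^ (∑ l ∈ S, (r l : ℝ)) = ∏ l ∈ S, (2 : ℝ) ^ (r l) := by
        rw [← Nat.cast_sum, Real.rpow_natCast, Finset.prod_pow_eq_pow_sum]
      rw [e] at this
      simp only [Subtype.forall] at this
      simpa [hc] using this
  have hz_bound : ∀ z, K * (N⁻¹ * ∑ f, ∑ k, (D k f z) ^ 2)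
      ≤ q z * (B * ∑ x : ∀ l, 𝒳 l, p (x, z)) := by
    intro z
    refine (sum_sq_le r F ev huniv (fun x => p (x, z)) (fun x => hp0 _)).trans ?_
    rw [hB, Finset.sum_mul, Finset.mul_sum]
    refine Finset.sum_le_sum fun S _ => ?_
    split_ifs with hS
    · rw [Finset.mul_sum, Finset.mul_sum, Finset.mul_sum]
      refine Finset.sum_le_sum fun x _ => ?_
      have := mul_le_mul_of_nonneg_left (hcS S z x) (hp0 (x, z))
      linarith
    · simp
  refine Real.le_sqrt_of_sq_le ?_
  have hterm : ∀ k f z, |N⁻¹ *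
          (∑ x : ∀ l, 𝒳 l, if ∀ l, ev l (f l) (x l) = k l then p (x, z) else 0)
        - K⁻¹ * N⁻¹ * (∑ x : ∀ l, 𝒳 l, p (x, z))| = N⁻¹ * |D k f z| := by
    intro k f z
    rw [← abs_of_pos (inv_pos.2 hNpos), ← abs_mul, abs_of_pos (inv_pos.2 hNpos)]
    congr 1
    simp only [hD]
    ring
  simp_rw [hterm]
  have hflat : ∀ G : (∀ l, Fin (r l) → Bool) → (∀ l, F l) → 𝒵 → ℝ,
      ∑ k, ∑ f, ∑ z, G k f z
      = ∑ t : (∀ l, Fin (r l) → Bool) × (∀ l, F l) × 𝒵, G t.1 t.2.1 t.2.2 := by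
    intro G
    simp [Fintype.sum_prod_type]
  rw [hflat (fun k f z => N⁻¹ * |D k f z|)]
  have hCS := Finset.sum_sq_le_sum_mul_sum_of_sq_eq_mul
    (Finset.univ : Finset ((∀ l, Fin (r l) → Bool) × (∀ l, F l) × 𝒵))
    (r := fun t => N⁻¹ * |D t.1 t.2.1 t.2.2|)
    (f := fun t => K⁻¹ * N⁻¹ * q t.2.2)
    (g := fun t => (q t.2.2)⁻¹ * (K * (N⁻¹ * (D t.1 t.2.1 t.2.2) ^ 2)))
    (fun t _ => mul_nonneg (by positivity) (hq0 _))
    (fun t _ => mul_nonneg (inv_nonneg.2 (hq0 _)) (by positivity))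
    (by
      rintro ⟨k, f, z⟩ _
      by_cases hz : q z = 0
      · simp [hD, hzero z hz]
      · simp only [mul_pow, sq_abs]
        field_simp)
  refine hCS.trans ?_
  rw [← hflat (fun k f z => K⁻¹ * N⁻¹ * q z),
    ← hflat (fun k f z => (q z)⁻¹ * (K * (N⁻¹ * (D k f z) ^ 2)))]
  have e1 : (∑ _k : ∀ l, Fin (r l) → Bool, ∑ _f : ∀ l, F l, ∑ z, K⁻¹ * N⁻¹ * q z) = 1 := by
    simp only [← Finset.mul_sum, hq1, Finset.sum_const, Finset.card_univ, nsmul_eq_mul, hcardK,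
      hcardN]
    field_simp
  have e2 : (∑ k, ∑ f, ∑ z, (q z)⁻¹ * (K * (N⁻¹ * (D k f z) ^ 2)))
      = ∑ z, (q z)⁻¹ * (K * (N⁻¹ * ∑ f, ∑ k, (D k f z) ^ 2)) := by
    simp_rw [Finset.mul_sum]
    rw [Finset.sum_comm]
    simp_rw [Finset.sum_comm (t := (Finset.univ : Finset 𝒵))]
  rw [e1, e2, one_mul]
  calc _ ≤ ∑ z, B * ∑ x : ∀ l, 𝒳 l, p (x, z) := by
        refine Finset.sum_le_sum fun z _ => ?_
        by_cases hz : q z = 0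
        · simp [hz, hzero z hz]
        · have hqp : 0 < q z := lt_of_le_of_ne (hq0 z) (Ne.symm hz)
          rw [inv_mul_le_iff₀ hqp]
          exact hz_bound z
    _ = B * ∑ ω : (∀ l, 𝒳 l) × 𝒵, p ω := by
        rw [← Finset.mul_sum, Fintype.sum_prod_type, Finset.sum_comm]
    _ ≤ B := mul_le_of_le_one_right hB0 hp1

end SecretSharing
end
end
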